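/- Let (a_n, b_n) be Jacobi parameters with Σ_{n≥1} (|b_n| + |a_n^2 − 1|) < ∞, with Jacobi operator J. Then for β in the open unit disc with β ≠ 0: u(β) = 0 if and only if β is real and β + β^{-1} is an eigenvalue of J. Moreover, every zero β of u in the open unit disc is simple, i.e. u'(β) ≠ 0. -/

import Mathlib

open Complex Metric Filter Topology MeasureTheory

/-- The Geronimo–Case recursion; here `a n`, `b n` denote the Jacobi parameters
`a_{n+1}`, `b_{n+1}` of the usual (1-indexed) notation. -/
def GCRec (a b : ℕ → ℝ) (c g : ℕ → ℂ → ℂ) : Prop :=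
  (∀ z, c 0 z = 1) ∧ (∀ z, g 0 z = 1) ∧
  (∀ n z, (a n : ℂ) * c (n + 1) z = (z ^ 2 - (b n : ℂ) * z) * c n z + g n z) ∧
  (∀ n z, (a n : ℂ) * g (n + 1) z =
    ((1 - (a n : ℂ) ^ 2) * z ^ 2 - (b n : ℂ) * z) * c n z + g n z)

/-- `v` is the Jost function of the Jacobi parameters `a b`: it is the pointwise limit
of the Geronimo–Case polynomials `g n` on the closed unit disc minus `±1`. -/
def IsJost (a b : ℕ → ℝ) (v : ℂ → ℂ) : Prop :=
  ∃ c g : ℕ → ℂ → ℂ, GCRec a b c g ∧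
    ∀ z ∈ Metric.closedBall (0 : ℂ) 1 \ ({1, -1} : Set ℂ),
      Filter.Tendsto (fun n => g n z) Filter.atTop (nhds (v z))

/-- `J` acts as the Jacobi matrix with parameters `a b` on `ℓ²(ℕ, ℂ)`; coordinate `n`
corresponds to the (1-indexed) site `n+1`. -/
def IsJacobiOpC (a b : ℕ → ℝ)
    (J : lp (fun _ : ℕ => ℂ) 2 →L[ℂ] lp (fun _ : ℕ => ℂ) 2) : Prop :=
  ∀ f : lp (fun _ : ℕ => ℂ) 2,
    ((J f : ∀ _ : ℕ, ℂ) 0 = (b 0 : ℂ) * (f : ∀ _ : ℕ, ℂ) 0 +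
      (a 0 : ℂ) * (f : ∀ _ : ℕ, ℂ) 1) ∧
    ∀ n : ℕ, (J f : ∀ _ : ℕ, ℂ) (n + 1) =
      (a n : ℂ) * (f : ∀ _ : ℕ, ℂ) n + (b (n + 1) : ℂ) * (f : ∀ _ : ℕ, ℂ) (n + 1) +
        (a (n + 1) : ℂ) * (f : ∀ _ : ℕ, ℂ) (n + 2)

/-- Forward growth bound for a pair of nonnegative sequences driven by a summable perturbation. -/
lemma exists_bound_of_perturbed_rec {q : ℝ} (hq1 : q < 1) {e : ℕ → ℝ}
    (he : ∀ n, 0 ≤ e n) (hs : Summable e) :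
    ∃ B : ℝ, ∀ x y : ℕ → ℝ, (∀ n, 0 ≤ x n) → x 0 ≤ 1 → y 0 ≤ 1 → 0 ≤ q →
      (∀ n, x (n + 1) ≤ (q + e n) * x n + y n) → (∀ n, y (n + 1) ≤ y n + e n * x n) →
      ∀ n, x n ≤ B := by
  have hd : 0 < 1 - q := by linarith
  refine ⟨Real.exp (∑' n, e n / (1 - q)) / (1 - q), fun x y hx hx0 hy0 hq hxr hyr n => ?_⟩
  have key : ∀ n, y n ≤ Real.exp (∑ k ∈ Finset.range n, e k / (1 - q)) ∧
      (1 - q) * x n ≤ Real.exp (∑ k ∈ Finset.range n, e k / (1 - q)) := by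
    intro n
    induction n with
    | zero => simp; constructor <;> nlinarith [hx 0]
    | succ n ih =>
      obtain ⟨h1, h2⟩ := ih
      rw [Finset.sum_range_succ, Real.exp_add]
      set P := Real.exp (∑ k ∈ Finset.range n, e k / (1 - q))
      have hP : 0 < P := Real.exp_pos _
      have h3 : e n / (1 - q) + 1 ≤ Real.exp (e n / (1 - q)) := Real.add_one_le_exp _
      have h4 : P * (e n / (1 - q) + 1) ≤ P * Real.exp (e n / (1 - q)) := by gcongr
      have h5 : x n ≤ P / (1 - q) := by rw [le_div_iff₀ hd]; linarith
      have h6 : e n * x n ≤ e n * (P / (1 - q)) := mul_le_mul_of_nonneg_left h5 (he n)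
      have h7 : P * (e n / (1 - q) + 1) = P + e n * (P / (1 - q)) := by ring
      constructor
      · linarith [hyr n]
      · have h8 : (1 - q) * x (n + 1) ≤ (1 - q) * ((q + e n) * x n + y n) :=
          mul_le_mul_of_nonneg_left (hxr n) hd.le
        have h9 : (1 - q) * y n ≤ (1 - q) * P := mul_le_mul_of_nonneg_left h1 hd.le
        have h10 : q * ((1 - q) * x n) ≤ q * P := mul_le_mul_of_nonneg_left h2 hq
        have h11 : 0 ≤ q * (e n * x n) := mul_nonneg hq (mul_nonneg (he n) (hx n))
        nlinarith
  rw [le_div_iff₀ hd]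
  have h := (key n).2
  have h' : ∑ k ∈ Finset.range n, e k / (1 - q) ≤ ∑' n, e n / (1 - q) :=
    (hs.div_const _).sum_le_tsum _ (fun k _ => div_nonneg (he k) hd.le)
  have := Real.exp_le_exp.2 h'
  linarith

/-- A sequence tending to zero is bounded by the tails of a majorant of its increments. -/
lemma norm_le_of_tendsto_zero_of_norm_sub_le {G : ℕ → ℂ} (hG : Tendsto G atTop (𝓝 0))
    {w : ℕ → ℝ} {k : ℕ} (hw : ∀ i, ‖G (i + k + 1) - G (i + k)‖ ≤ w i) {S : ℝ}
    (hS : HasSum w S) : ‖G k‖ ≤ S := by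
  have h1 : ∀ m, ‖G (m + k) - G k‖ ≤ S := by
    intro m
    have : G (m + k) - G k = ∑ i ∈ Finset.range m, (G (i + k + 1) - G (i + k)) := by
      have := Finset.sum_range_sub (fun i => G (i + k)) m
      simp only [zero_add] at this
      rw [← this]
      refine Finset.sum_congr rfl fun i _ => ?_
      rw [add_right_comm]
    rw [this]
    refine (norm_sum_le _ _).trans ((Finset.sum_le_sum fun i _ => hw i).trans ?_)
    exact sum_le_hasSum _ (fun i _ => (norm_nonneg _).trans (hw i)) hS
  have h2 : Tendsto (fun m => ‖G (m + k) - G k‖) atTop (𝓝 ‖0 - G k‖) :=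
    (((tendsto_add_atTop_iff_nat k).2 hG).sub_const _).norm
  simpa using le_of_tendsto' h2 h1

/-- If `G` tends to zero, then a bounded solution of the perturbed recursion with
geometrically small forcing decays geometrically. -/
lemma exists_geometric_bound {q σ K : ℝ} (hq : 0 ≤ q) (hqσ : q < σ) (hσ : σ < 1) (hK : 0 ≤ K)
    {e : ℕ → ℝ} (he : ∀ n, 0 ≤ e n) (hs : Summable e)
    {x : ℕ → ℝ} (hx : ∀ n, 0 ≤ x n) {G : ℕ → ℂ} (hG : Tendsto G atTop (𝓝 0))
    {B₀ : ℝ} (hB₀ : ∀ n, x n ≤ B₀)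
    (hxr : ∀ n, x (n + 1) ≤ (q + e n) * x n + ‖G n‖ + K * σ ^ n)
    (hGr : ∀ n, ‖G (n + 1) - G n‖ ≤ e n * x n + K * σ ^ n) :
    ∃ M : ℝ, 0 ≤ M ∧ ∀ n, x n ≤ M * σ ^ n ∧ ‖G n‖ ≤ M * σ ^ n := by
  have hσ0 : 0 < σ := hq.trans_lt hqσ
  have hσ1 : 0 < 1 - σ := by linarith
  set T : ℕ → ℝ := fun k => ∑' i, e (i + k) with hT
  have hT0 : Tendsto T atTop (𝓝 0) := tendsto_sum_nat_add e
  have hTn : ∀ k, 0 ≤ T k := fun k => tsum_nonneg fun i => he _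
  have tail : ∀ k s, (∀ j, k ≤ j → x j ≤ s) → ‖G k‖ ≤ s * T k + K / (1 - σ) * σ ^ k := by
    intro k s hsx
    have hsum : HasSum (fun i => s * e (i + k) + K * σ ^ k * σ ^ i)
        (s * T k + K * σ ^ k * (1 - σ)⁻¹) :=
      ((((summable_nat_add_iff k).2 hs).hasSum).mul_left s).add
        ((hasSum_geometric_of_lt_one hσ0.le hσ).mul_left _)
    have hk : ∀ i, ‖G (i + k + 1) - G (i + k)‖ ≤ s * e (i + k) + K * σ ^ k * σ ^ i := by
      intro i
      refine (hGr (i + k)).trans ?_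
      have := mul_le_mul_of_nonneg_left (hsx (i + k) (by omega)) (he (i + k))
      rw [pow_add]
      nlinarith
    have := norm_le_of_tendsto_zero_of_norm_sub_le (k := k) hG hk hsum
    convert this using 2
    field_simp
  obtain ⟨n₀, hn₀⟩ : ∃ n₀, ∀ k ≥ n₀, e k + T k < (σ - q) / 2 := by
    have := (hs.tendsto_atTop_zero.add hT0).eventually_lt_const (u := (σ - q) / 2)
      (by simpa using hqσ)
    exact eventually_atTop.1 this
  set K' := K + K / (1 - σ) with hK'
  set B := max B₀ (K' * σ ^ n₀ * 2 / (σ - q)) with hB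
  have hB1 : B₀ ≤ B := le_max_left _ _
  have hB0 : 0 ≤ B := (hx 0).trans ((hB₀ 0).trans hB1)
  have hB2 : K' * σ ^ n₀ ≤ B * ((σ - q) / 2) := by
    have : K' * σ ^ n₀ * 2 / (σ - q) ≤ B := le_max_right _ _
    rw [div_le_iff₀ (by linarith)] at this
    linarith
  have hK'0 : 0 ≤ K' := by positivity
  have claim : ∀ j k, n₀ + j ≤ k → x k ≤ B * σ ^ j := by
    intro j
    induction j with
    | zero => intro k _; simpa using (hB₀ k).trans hB1
    | succ j ih =>
      intro k hk
      obtain ⟨k, rfl⟩ : ∃ k', k = k' + 1 := ⟨k - 1, by omega⟩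
      have hk' : n₀ + j ≤ k := by omega
      have h1 := hxr k
      have h2 := tail k _ (fun i hi => ih i (hk'.trans hi))
      have h3 := hn₀ k (by omega)
      have h4 := mul_le_mul_of_nonneg_left (ih k hk') (add_nonneg hq (he k))
      have h5 : K' * σ ^ k ≤ K' * σ ^ n₀ * σ ^ j := by
        rw [mul_assoc, ← pow_add]
        exact mul_le_mul_of_nonneg_left (pow_le_pow_of_le_one hσ0.le hσ.le hk') hK'0
      have hs0 : 0 < σ ^ j := by positivity
      have h6 := mul_le_mul_of_nonneg_right hB2 hs0.le
      have h7 : (e k + T k) * (B * σ ^ j) ≤ (σ - q) / 2 * (B * σ ^ j) :=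
        mul_le_mul_of_nonneg_right h3.le (by positivity)
      have h8 : K' * σ ^ k = K * σ ^ k + K / (1 - σ) * σ ^ k := by rw [hK']; ring
      rw [pow_succ]
      nlinarith
  set M := B / σ ^ n₀ with hM
  have hM0 : 0 ≤ M := by positivity
  have hxM : ∀ n, x n ≤ M * σ ^ n := by
    intro n
    rw [hM, div_mul_eq_mul_div, le_div_iff₀ (by positivity)]
    rcases le_total n₀ n with h | h
    · have := claim (n - n₀) n (by omega)
      calc x n * σ ^ n₀ ≤ B * σ ^ (n - n₀) * σ ^ n₀ := by gcongr
        _ = B * σ ^ n := by rw [mul_assoc, ← pow_add]; congr 2; omega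
    · exact mul_le_mul ((hB₀ n).trans hB1) (pow_le_pow_of_le_one hσ0.le hσ.le h)
        (by positivity) hB0
  have hTle : ∀ k, T k ≤ T 0 := by
    intro k
    have := hs.sum_add_tsum_nat_add k
    have h0 : 0 ≤ ∑ i ∈ Finset.range k, e i := Finset.sum_nonneg fun i _ => he i
    simp only [hT, add_zero]
    linarith
  refine ⟨M + (M * T 0 + K / (1 - σ)), by have := hTn 0; positivity, fun n => ⟨?_, ?_⟩⟩
  · refine (hxM n).trans ?_
    have := hTn 0
    have h0 : 0 ≤ (M * T 0 + K / (1 - σ)) := by positivity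
    gcongr
    linarith
  · have h1 := tail n (M * σ ^ n) (fun j hj => (hxM j).trans
      (mul_le_mul_of_nonneg_left (pow_le_pow_of_le_one hσ0.le hσ.le hj) hM0))
    have h2 : M * σ ^ n * T n ≤ M * σ ^ n * T 0 :=
      mul_le_mul_of_nonneg_left (hTle n) (by positivity)
    have h3 : 0 ≤ M * σ ^ n := by positivity
    nlinarith

/-- The partial products of a positive sequence `a` with `∑ |a n ^ 2 - 1| < ∞` converge and are
bounded away from zero. -/
lemma exists_tendsto_prod_of_summable {a : ℕ → ℝ} (hpos : ∀ n, 0 < a n)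
    (hs : Summable fun n => |a n ^ 2 - 1|) :
    (∃ L : ℝ, Tendsto (fun n => ∏ k ∈ Finset.range n, a k) atTop (𝓝 L)) ∧
      ∃ m : ℝ, 0 < m ∧ ∀ n, m ≤ ∏ k ∈ Finset.range n, a k := by
  have hs1 : Summable fun n => a n - 1 := by
    refine Summable.of_norm_bounded hs fun n => ?_
    rw [Real.norm_eq_abs, show a n ^ 2 - 1 = (a n - 1) * (a n + 1) by ring, abs_mul]
    have h1 : 1 ≤ |a n + 1| := by rw [abs_of_pos] <;> linarith [hpos n]
    nlinarith [abs_nonneg (a n - 1)]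
  have hlog : Summable fun n => Real.log (a n) := by
    simpa using Real.summable_log_one_add_of_summable hs1
  have hprod : ∀ n, ∏ k ∈ Finset.range n, a k =
      Real.exp (∑ k ∈ Finset.range n, Real.log (a k)) := fun n => by
    rw [Real.exp_sum]
    exact Finset.prod_congr rfl fun k _ => (Real.exp_log (hpos k)).symm
  simp only [hprod]
  refine ⟨⟨_, (Real.continuous_exp.tendsto _).comp hlog.hasSum.tendsto_sum_nat⟩, ?_⟩
  obtain ⟨l, hl⟩ := hlog.hasSum.tendsto_sum_nat.bddBelow_range
  exact ⟨Real.exp l, Real.exp_pos _, fun n => Real.exp_le_exp.2 (hl ⟨n, rfl⟩)⟩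

/-- The Geronimo–Case recursion after multiplying the `n`-th polynomials by `∏ k < n, a k`. -/
def IsNormalizedGC (a b : ℕ → ℝ) (C G : ℕ → ℂ → ℂ) : Prop :=
  (∀ z, C 0 z = 1) ∧ (∀ z, G 0 z = 1) ∧
  (∀ n z, C (n + 1) z = (z ^ 2 - (b n : ℂ) * z) * C n z + G n z) ∧
  (∀ n z, G (n + 1) z = ((1 - (a n : ℂ) ^ 2) * z ^ 2 - (b n : ℂ) * z) * C n z + G n z)

lemma GCRec.isNormalizedGC {a b : ℕ → ℝ} {c g : ℕ → ℂ → ℂ} (h : GCRec a b c g) :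
    IsNormalizedGC a b (fun n z => ((∏ k ∈ Finset.range n, a k : ℝ) : ℂ) * c n z)
      (fun n z => ((∏ k ∈ Finset.range n, a k : ℝ) : ℂ) * g n z) := by
  obtain ⟨h1, h2, h3, h4⟩ := h
  refine ⟨fun z => by simp [h1], fun z => by simp [h2], fun n z => ?_, fun n z => ?_⟩
  · simp only [Finset.prod_range_succ, Complex.ofReal_mul]
    rw [mul_assoc, h3]; ring
  · simp only [Finset.prod_range_succ, Complex.ofReal_mul]
    rw [mul_assoc, h4]; ring

namespace IsNormalizedGC

variable {a b : ℕ → ℝ} {C G : ℕ → ℂ → ℂ}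

lemma differentiable (h : IsNormalizedGC a b C G) (n : ℕ) :
    Differentiable ℂ (C n) ∧ Differentiable ℂ (G n) := by
  obtain ⟨h1, h2, h3, h4⟩ := h
  induction n with
  | zero =>
    rw [funext h1, funext h2]
    exact ⟨differentiable_const _, differentiable_const _⟩
  | succ n ih =>
    obtain ⟨i1, i2⟩ := ih
    rw [funext (h3 n), funext (h4 n)]
    constructor <;> fun_prop

lemma exists_real (h : IsNormalizedGC a b C G) (t : ℝ) (n : ℕ) :
    ∃ r s : ℝ, C n t = r ∧ G n t = s := by
  obtain ⟨h1, h2, h3, h4⟩ := h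
  induction n with
  | zero => exact ⟨1, 1, by simp [h1], by simp [h2]⟩
  | succ n ih =>
    obtain ⟨r, s, hr, hs⟩ := ih
    refine ⟨(t ^ 2 - b n * t) * r + s, ((1 - a n ^ 2) * t ^ 2 - b n * t) * r + s, ?_, ?_⟩
    · rw [h3, hr, hs]; push_cast; ring
    · rw [h4, hr, hs]; push_cast; ring

lemma norm_one_sub_sq (α : ℝ) : ‖1 - (α : ℂ) ^ 2‖ = |α ^ 2 - 1| := by
  rw [abs_sub_comm, ← Real.norm_eq_abs, ← Complex.norm_real]
  push_cast
  rfl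

lemma norm_coeff_C_le {z : ℂ} (hz : ‖z‖ ≤ 1) (α γ : ℝ) :
    ‖z ^ 2 - (γ : ℂ) * z‖ ≤ ‖z‖ ^ 2 + (|γ| + |α ^ 2 - 1|) := by
  refine (norm_sub_le _ _).trans ?_
  rw [norm_pow, norm_mul, Complex.norm_real, Real.norm_eq_abs]
  nlinarith [abs_nonneg γ, abs_nonneg (α ^ 2 - 1)]

lemma norm_coeff_G_le {z : ℂ} (hz : ‖z‖ ≤ 1) (α γ : ℝ) :
    ‖(1 - (α : ℂ) ^ 2) * z ^ 2 - (γ : ℂ) * z‖ ≤ |γ| + |α ^ 2 - 1| := by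
  refine (norm_sub_le _ _).trans ?_
  rw [norm_mul, norm_mul, norm_one_sub_sq, norm_pow, Complex.norm_real, Real.norm_eq_abs]
  have h2 : ‖z‖ ^ 2 ≤ 1 := by nlinarith [norm_nonneg z]
  nlinarith [abs_nonneg γ, abs_nonneg (α ^ 2 - 1)]

lemma norm_G_succ_sub_le (h : IsNormalizedGC a b C G) {z : ℂ} (hz : ‖z‖ ≤ 1) (n : ℕ) :
    ‖G (n + 1) z - G n z‖ ≤ (|b n| + |a n ^ 2 - 1|) * ‖C n z‖ := by
  rw [h.2.2.2, add_sub_cancel_right, norm_mul]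
  gcongr
  exact norm_coeff_G_le hz _ _

lemma norm_C_succ_le (h : IsNormalizedGC a b C G) {z : ℂ} (hz : ‖z‖ ≤ 1) (n : ℕ) :
    ‖C (n + 1) z‖ ≤ (‖z‖ ^ 2 + (|b n| + |a n ^ 2 - 1|)) * ‖C n z‖ + ‖G n z‖ := by
  rw [h.2.2.1]
  refine (norm_add_le _ _).trans ?_
  rw [norm_mul]
  gcongr
  exact norm_coeff_C_le hz _ _

lemma exists_bound (h : IsNormalizedGC a b C G)
    (hsum : Summable fun n => |b n| + |a n ^ 2 - 1|) {r : ℝ} (hr0 : 0 ≤ r) (hr : r < 1) :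
    ∃ B : ℝ, ∀ n z, ‖z‖ ≤ r → ‖C n z‖ ≤ B := by
  have hq : r ^ 2 < 1 := by nlinarith
  obtain ⟨B, hB⟩ := exists_bound_of_perturbed_rec hq (fun n => by positivity) hsum
  refine ⟨B, fun n z hz => hB (fun n => ‖C n z‖) (fun n => ‖G n z‖) (fun n => norm_nonneg _)
    (by simp [h.1]) (by simp [h.2.1]) (sq_nonneg r) (fun n => ?_) (fun n => ?_) n⟩
  · refine (h.norm_C_succ_le (hz.trans hr.le) n).trans ?_
    have : ‖z‖ ^ 2 ≤ r ^ 2 := by gcongr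
    gcongr
  · have h1 := h.norm_G_succ_sub_le (hz.trans hr.le) n
    have h2 := norm_sub_norm_le (G (n + 1) z) (G n z)
    linarith

lemma exists_tendstoUniformlyOn (h : IsNormalizedGC a b C G)
    (hsum : Summable fun n => |b n| + |a n ^ 2 - 1|) {r : ℝ} (hr0 : 0 ≤ r) (hr : r < 1) :
    ∃ U : ℂ → ℂ, TendstoUniformlyOn G U atTop (ball 0 r) := by
  obtain ⟨B, hB⟩ := h.exists_bound hsum hr0 hr
  have h1 := tendstoUniformlyOn_tsum_nat (s := ball (0 : ℂ) r)
    (f := fun n z => G (n + 1) z - G n z) (hsum.mul_right B) (fun n z hz => by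
      have hz' : ‖z‖ ≤ r := (mem_ball_zero_iff.1 hz).le
      refine (h.norm_G_succ_sub_le (hz'.trans hr.le) n).trans ?_
      gcongr
      exact hB n z hz')
  refine ⟨fun z => (∑' n, (G (n + 1) z - G n z)) + 1, ?_⟩
  rw [Metric.tendstoUniformlyOn_iff] at h1 ⊢
  intro ε hε
  filter_upwards [h1 ε hε] with n hn z hz
  have := hn z hz
  rw [Finset.sum_range_sub (fun n => G n z), h.2.1] at this
  simpa [dist_eq_norm, sub_add_eq_sub_sub, sub_sub_eq_add_sub] using this

/-- If `L * u` is the pointwise limit of `G` on the disc, then the derivatives converge too. -/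
lemma tendsto_deriv (h : IsNormalizedGC a b C G)
    (hsum : Summable fun n => |b n| + |a n ^ 2 - 1|) {v : ℂ → ℂ}
    (hv : ∀ z ∈ ball (0 : ℂ) 1, Tendsto (fun n => G n z) atTop (𝓝 (v z)))
    {β : ℂ} (hβ : β ∈ ball (0 : ℂ) 1) :
    Tendsto (fun n => deriv (G n) β) atTop (𝓝 (deriv v β)) := by
  obtain ⟨r, hr1, hr⟩ := exists_between (mem_ball_zero_iff.1 hβ)
  have hr0 : 0 ≤ r := (norm_nonneg β).trans hr1.le
  obtain ⟨U, hU⟩ := h.exists_tendstoUniformlyOn hsum hr0 hr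
  have hUv : TendstoUniformlyOn G v atTop (ball 0 r) := hU.congr_right fun z hz =>
    tendsto_nhds_unique (hU.tendsto_at hz) (hv z (ball_subset_ball hr.le hz))
  exact (hUv.tendstoLocallyUniformlyOn.deriv (Eventually.of_forall fun n =>
    (h.differentiable n).2.differentiableOn) isOpen_ball).tendsto_at (mem_ball_zero_iff.2 hr1)

lemma exists_decay (h : IsNormalizedGC a b C G)
    (hsum : Summable fun n => |b n| + |a n ^ 2 - 1|) {β : ℂ} (hβ : ‖β‖ < 1) {σ : ℝ}
    (hβσ : ‖β‖ ^ 2 < σ) (hσ : σ < 1) (hG : Tendsto (fun n => G n β) atTop (𝓝 0)) :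
    ∃ M : ℝ, 0 ≤ M ∧ ∀ n, ‖C n β‖ ≤ M * σ ^ n ∧ ‖G n β‖ ≤ M * σ ^ n := by
  obtain ⟨B, hB⟩ := h.exists_bound hsum (norm_nonneg β) hβ
  refine exists_geometric_bound (sq_nonneg _) hβσ hσ le_rfl (fun n => by positivity) hsum
    (fun n => norm_nonneg _) hG (fun n => hB n β le_rfl) (fun n => ?_) (fun n => ?_)
  · simpa using h.norm_C_succ_le hβ.le n
  · simpa using h.norm_G_succ_sub_le hβ.le n

lemma deriv_C_succ (h : IsNormalizedGC a b C G) (n : ℕ) (z : ℂ) :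
    deriv (C (n + 1)) z = (z ^ 2 - (b n : ℂ) * z) * deriv (C n) z + deriv (G n) z +
      (2 * z - b n) * C n z := by
  rw [funext (h.2.2.1 n)]
  have h1 := ((h.differentiable n).1 z).hasDerivAt
  have h2 := ((h.differentiable n).2 z).hasDerivAt
  have h3 := ((hasDerivAt_pow 2 z).sub ((hasDerivAt_id z).const_mul (b n : ℂ)))
  have := ((h3.mul h1).add h2).deriv
  refine Eq.trans this ?_
  simp
  ring

lemma deriv_G_succ (h : IsNormalizedGC a b C G) (n : ℕ) (z : ℂ) :
    deriv (G (n + 1)) z = ((1 - (a n : ℂ) ^ 2) * z ^ 2 - (b n : ℂ) * z) * deriv (C n) z +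
      deriv (G n) z + (2 * (1 - (a n : ℂ) ^ 2) * z - b n) * C n z := by
  rw [funext (h.2.2.2 n)]
  have h1 := ((h.differentiable n).1 z).hasDerivAt
  have h2 := ((h.differentiable n).2 z).hasDerivAt
  have h3 := (((hasDerivAt_pow 2 z).const_mul (1 - (a n : ℂ) ^ 2)).sub
    ((hasDerivAt_id z).const_mul (b n : ℂ)))
  have := ((h3.mul h1).add h2).deriv
  refine Eq.trans this ?_
  simp
  ring

lemma exists_deriv_decay (h : IsNormalizedGC a b C G)
    (hsum : Summable fun n => |b n| + |a n ^ 2 - 1|) {β : ℂ} (hβ : ‖β‖ < 1) {σ : ℝ}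
    (hβσ : ‖β‖ ^ 2 < σ) (hσ : σ < 1) {M : ℝ} (hM : 0 ≤ M) (hC : ∀ n, ‖C n β‖ ≤ M * σ ^ n)
    (hG : Tendsto (fun n => deriv (G n) β) atTop (𝓝 0)) :
    ∃ M : ℝ, 0 ≤ M ∧ ∀ n, ‖deriv (C n) β‖ ≤ M * σ ^ n ∧ ‖deriv (G n) β‖ ≤ M * σ ^ n := by
  obtain ⟨r, hr1, hr⟩ := exists_between hβ
  obtain ⟨B, hB⟩ := h.exists_bound hsum ((norm_nonneg β).trans hr1.le) hr
  have hB' : ∀ n, ‖deriv (C n) β‖ ≤ B / (r - ‖β‖) := fun n =>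
    Complex.norm_deriv_le_of_forall_mem_sphere_norm_le (sub_pos.2 hr1)
      (h.differentiable n).1.diffContOnCl fun z hz => hB n z (by
        have h1 : ‖z - β‖ = r - ‖β‖ := by simpa [dist_eq_norm] using hz
        have h2 := norm_sub_norm_le z β
        linarith)
  set S := ∑' n, (|b n| + |a n ^ 2 - 1|) with hS
  have hbS : ∀ n, |b n| + |a n ^ 2 - 1| ≤ S := fun n => hsum.le_tsum n fun k _ => by positivity
  have hS0 : 0 ≤ S := tsum_nonneg fun n => by positivity
  refine exists_geometric_bound (K := (2 + 2 * S) * M) (sq_nonneg _) hβσ hσ (by positivity)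
    (fun n => by positivity) hsum (fun n => norm_nonneg _) hG hB' (fun n => ?_) (fun n => ?_)
  · rw [h.deriv_C_succ]
    refine (norm_add_le _ _).trans (add_le_add ((norm_add_le _ _).trans ?_) ?_)
    · rw [norm_mul]
      gcongr
      exact norm_coeff_C_le hβ.le _ _
    · rw [norm_mul, mul_assoc (2 + 2 * S)]
      gcongr
      · refine (norm_sub_le _ _).trans ?_
        rw [norm_mul, Complex.norm_real, Real.norm_eq_abs]
        have := hbS n
        simp only [Complex.norm_ofNat]
        linarith [abs_nonneg (a n ^ 2 - 1)]
      · exact hC n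
  · rw [h.deriv_G_succ, add_right_comm, add_sub_cancel_right]
    refine (norm_add_le _ _).trans (add_le_add ?_ ?_)
    · rw [norm_mul]
      gcongr
      exact norm_coeff_G_le hβ.le _ _
    · rw [norm_mul, mul_assoc (2 + 2 * S)]
      gcongr
      · refine (norm_sub_le _ _).trans ?_
        rw [norm_mul, norm_mul, norm_one_sub_sq, Complex.norm_real, Real.norm_eq_abs, Complex.norm_ofNat]
        have := hbS n
        nlinarith [abs_nonneg (a n ^ 2 - 1), abs_nonneg (b n)]
      · exact hC n

/-- Confluent Christoffel–Darboux formula in the variable `z`, as a lower bound: the Wronskian of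
the solution and its derivative at a real point dominates the leading term of the sum. -/
lemma exists_wronskian_eq (h : IsNormalizedGC a b C G) {t : ℝ} (ht : t ≠ 0) (n : ℕ) :
    ∃ s : ℝ, (∏ k ∈ Finset.range n, a k) ^ 2 ≤ s ∧
      t * (deriv (G n) t * C n t - deriv (C n) t * G n t) + t ^ 2 * C n t ^ 2 - G n t * C n t =
        ((t : ℂ) ^ 2 - 1) * t ^ (2 * n) * s := by
  induction n with
  | zero =>
    refine ⟨1, by simp, ?_⟩
    rw [funext h.1, funext h.2.1]
    simp
  | succ n ih =>
    obtain ⟨s, hs, hW⟩ := ih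
    obtain ⟨r, -, hr, -⟩ := h.exists_real t (n + 1)
    refine ⟨a n ^ 2 * s + (r / t ^ (n + 1)) ^ 2, ?_, ?_⟩
    · rw [Finset.prod_range_succ, mul_pow]
      nlinarith [sq_nonneg (a n), sq_nonneg (r / t ^ (n + 1))]
    · have ht' : (t : ℂ) ≠ 0 := by exact_mod_cast ht
      have hrhs : ((t : ℂ) ^ 2 - 1) * t ^ (2 * (n + 1)) *
          ((a n ^ 2 * s + (r / t ^ (n + 1)) ^ 2 : ℝ) : ℂ) =
          a n ^ 2 * t ^ 2 * (((t : ℂ) ^ 2 - 1) * t ^ (2 * n) * s) +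
            ((t : ℂ) ^ 2 - 1) * C (n + 1) t ^ 2 := by
        rw [hr]; push_cast; field_simp; ring
      rw [hrhs, ← hW, h.deriv_C_succ, h.deriv_G_succ, h.2.2.1, h.2.2.2]
      ring

lemma not_tendsto_deriv_zero (h : IsNormalizedGC a b C G)
    (hsum : Summable fun n => |b n| + |a n ^ 2 - 1|) {m : ℝ} (hm : 0 < m)
    (hma : ∀ n, m ≤ ∏ k ∈ Finset.range n, a k) {t : ℝ} (ht0 : t ≠ 0) (ht1 : |t| < 1)
    (hG : Tendsto (fun n => G n t) atTop (𝓝 0)) :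
    ¬ Tendsto (fun n => deriv (G n) t) atTop (𝓝 0) := by
  intro hG'
  have hn : ‖(t : ℂ)‖ = |t| := by simp
  have ht : 0 < |t| := abs_pos.2 ht0
  obtain ⟨σ, hσ1, hσ2⟩ := exists_between (show |t| ^ 2 < |t| by nlinarith)
  have hσ0 : 0 < σ := (sq_nonneg _).trans_lt hσ1
  obtain ⟨M, hM, hd⟩ := h.exists_decay hsum (hn ▸ ht1) (σ := σ) (hn ▸ hσ1) (hσ2.trans ht1) hG
  obtain ⟨N, hN, hd'⟩ := h.exists_deriv_decay hsum (hn ▸ ht1) (σ := σ) (hn ▸ hσ1)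
    (hσ2.trans ht1) hM (fun n => (hd n).1) hG'
  have key : ∀ n, (1 - t ^ 2) * m ^ 2 ≤ (2 * N * M + 2 * M ^ 2) * (σ ^ 2 / |t| ^ 2) ^ n := by
    intro n
    obtain ⟨s, hs, hW⟩ := h.exists_wronskian_eq ht0 n
    have hs' : m ^ 2 ≤ s := (pow_le_pow_left₀ hm.le (hma n) 2).trans hs
    have h0 : 0 ≤ 1 - t ^ 2 := by nlinarith [sq_abs t]
    have h1 := congrArg norm hW
    have h2 : ‖((t : ℂ) ^ 2 - 1) * t ^ (2 * n) * s‖ = (1 - t ^ 2) * (|t| ^ 2) ^ n * s := by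
      rw [norm_mul, norm_mul, norm_pow, hn, Complex.norm_real, Real.norm_eq_abs,
        abs_of_nonneg ((sq_nonneg m).trans hs'), pow_mul]
      congr 2
      rw [← norm_neg, neg_sub, ← abs_of_nonneg h0, ← Real.norm_eq_abs, ← Complex.norm_real]
      push_cast; rfl
    obtain ⟨c1, g1⟩ := hd n
    obtain ⟨c2, g2⟩ := hd' n
    have e1 : ‖deriv (G n) t * C n t‖ ≤ N * σ ^ n * (M * σ ^ n) := by
      rw [norm_mul]; gcongr
    have e2 : ‖deriv (C n) t * G n t‖ ≤ N * σ ^ n * (M * σ ^ n) := by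
      rw [norm_mul]; gcongr
    have e3 : ‖C n t ^ 2‖ ≤ (M * σ ^ n) ^ 2 := by
      rw [norm_pow]; gcongr
    have e4 : ‖G n t * C n t‖ ≤ M * σ ^ n * (M * σ ^ n) := by
      rw [norm_mul]; gcongr
    have h3 : ‖t * (deriv (G n) t * C n t - deriv (C n) t * G n t) + t ^ 2 * C n t ^ 2
        - G n t * C n t‖ ≤ (2 * N * M + 2 * M ^ 2) * (σ ^ 2) ^ n := by
      have f1 : ‖t * (deriv (G n) t * C n t - deriv (C n) t * G n t)‖ ≤
          1 * (N * σ ^ n * (M * σ ^ n) + N * σ ^ n * (M * σ ^ n)) := by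
        rw [norm_mul, hn]
        exact mul_le_mul ht1.le ((norm_sub_le _ _).trans (add_le_add e1 e2)) (norm_nonneg _)
          zero_le_one
      have f2 : ‖(t : ℂ) ^ 2 * C n t ^ 2‖ ≤ 1 * (M * σ ^ n) ^ 2 := by
        rw [norm_mul, norm_pow, hn]
        exact mul_le_mul (by nlinarith) e3 (norm_nonneg _) zero_le_one
      have f3 := norm_sub_le (t * (deriv (G n) t * C n t - deriv (C n) t * G n t)
        + t ^ 2 * C n t ^ 2) (G n t * C n t)
      have f4 := norm_add_le (t * (deriv (G n) t * C n t - deriv (C n) t * G n t))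
        ((t : ℂ) ^ 2 * C n t ^ 2)
      have f5 : (σ ^ 2) ^ n = σ ^ n * σ ^ n := by rw [← pow_mul, mul_comm, pow_mul, sq]
      rw [f5]
      linarith
    rw [h1, h2] at h3
    rw [div_pow, ← mul_div_assoc, le_div_iff₀ (by positivity)]
    refine le_trans ?_ h3
    rw [mul_right_comm]
    gcongr
  have hlim : Tendsto (fun n : ℕ => (2 * N * M + 2 * M ^ 2) * (σ ^ 2 / |t| ^ 2) ^ n) atTop
      (𝓝 ((2 * N * M + 2 * M ^ 2) * 0)) := by
    refine (tendsto_pow_atTop_nhds_zero_of_lt_one (by positivity) ?_).const_mul _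
    rw [div_lt_one (by positivity)]
    gcongr
  have := ge_of_tendsto' hlim key
  have h1 : 0 < 1 - t ^ 2 := by nlinarith [sq_abs t]
  have : 0 < (1 - t ^ 2) * m ^ 2 := by positivity
  linarith

end IsNormalizedGC

/-- A solution of the eigenvalue equation for a Jacobi matrix that decays has a real
eigenvalue. -/
lemma im_eq_zero_of_jacobi_eigenvector {a b : ℕ → ℝ} {x : ℂ} {f : ℕ → ℂ}
    (h0 : x * f 0 = b 0 * f 0 + a 0 * f 1)
    (h1 : ∀ n, x * f (n + 1) = a n * f n + b (n + 1) * f (n + 1) + a (n + 1) * f (n + 2))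
    (ha : BddAbove (Set.range a)) (ha0 : ∀ n, 0 < a n) (hf : Tendsto f atTop (𝓝 0))
    (hf0 : f 0 ≠ 0) : x.im = 0 := by
  obtain ⟨R, hR⟩ := ha
  have key : ∀ n, (a n * f (n + 1) * (starRingEnd ℂ) (f n)).im =
      x.im * ∑ k ∈ Finset.range (n + 1), Complex.normSq (f k) := by
    intro n
    induction n with
    | zero =>
      have : (a 0 * f 1 * (starRingEnd ℂ) (f 0)) = (x - b 0) * Complex.normSq (f 0) := by
        rw [← Complex.mul_conj]; linear_combination -(starRingEnd ℂ) (f 0) * h0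
      simp [this]
    | succ n ih =>
      have : (a (n + 1) * f (n + 2) * (starRingEnd ℂ) (f (n + 1))) =
          (x - b (n + 1)) * Complex.normSq (f (n + 1)) -
            a n * f n * (starRingEnd ℂ) (f (n + 1)) := by
        rw [← Complex.mul_conj]; linear_combination -(starRingEnd ℂ) (f (n + 1)) * h1 n
      rw [Finset.sum_range_succ, mul_add, ← ih, this]
      simp
      ring
  have hlim : Tendsto (fun n => R * (‖f (n + 1)‖ * ‖f n‖)) atTop
      (𝓝 (R * (‖(0 : ℂ)‖ * ‖(0 : ℂ)‖))) :=
    ((((tendsto_add_atTop_iff_nat 1).2 hf).norm).mul hf.norm).const_mul R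
  have hle : ∀ n, |x.im| * Complex.normSq (f 0) ≤ R * (‖f (n + 1)‖ * ‖f n‖) := by
    intro n
    have h2 := (Complex.abs_im_le_norm (a n * f (n + 1) * (starRingEnd ℂ) (f n)))
    rw [key, abs_mul, norm_mul, norm_mul, RCLike.norm_conj, Complex.norm_real, Real.norm_eq_abs,
      abs_of_pos (ha0 n), mul_assoc] at h2
    have h3 : Complex.normSq (f 0) ≤ |∑ k ∈ Finset.range (n + 1), Complex.normSq (f k)| :=
      (Finset.single_le_sum (f := fun k => Complex.normSq (f k))
        (fun k _ => Complex.normSq_nonneg _) (by simp)).trans (le_abs_self _)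
    have h4 : a n ≤ R := hR ⟨n, rfl⟩
    calc _ ≤ |x.im| * |∑ k ∈ Finset.range (n + 1), Complex.normSq (f k)| := by gcongr
      _ ≤ _ := h2
      _ ≤ _ := by gcongr
  have := ge_of_tendsto' hlim hle
  have h5 : 0 < Complex.normSq (f 0) := Complex.normSq_pos.2 hf0
  simp only [norm_zero, mul_zero] at this
  exact abs_nonpos_iff.1 (nonpos_of_mul_nonpos_left this h5)

lemma im_eq_zero_of_add_inv_im_eq_zero {β : ℂ} (hβ : ‖β‖ < 1) (hβ0 : β ≠ 0)
    (h : (β + β⁻¹).im = 0) : β.im = 0 := by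
  have h1 : 0 < Complex.normSq β := Complex.normSq_pos.2 hβ0
  have h2 : Complex.normSq β < 1 := by
    rw [Complex.normSq_eq_norm_sq]; nlinarith [norm_nonneg β]
  rw [Complex.add_im, Complex.inv_im] at h
  field_simp at h
  by_contra h3
  have : β.im * (Complex.normSq β - 1) = 0 := by linear_combination h
  rcases mul_eq_zero.1 this with h4 | h4
  · exact h3 h4
  · linarith

namespace GCRec

variable {a b : ℕ → ℝ} {c g : ℕ → ℂ → ℂ}

lemma g_succ (h : GCRec a b c g) (hpos : ∀ n, 0 < a n) (n : ℕ) (z : ℂ) :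
    g (n + 1) z = c (n + 1) z - a n * z ^ 2 * c n z := by
  have ha : (a n : ℂ) ≠ 0 := by exact_mod_cast (hpos n).ne'
  apply mul_left_cancel₀ ha
  linear_combination h.2.2.2 n z - h.2.2.1 n z

/-- `n ↦ c n β / β ^ n` solves the Jacobi eigenvalue equation. -/
lemma eigenvector_zero (h : GCRec a b c g) {β : ℂ} (hβ : β ≠ 0) :
    (β + β⁻¹) * (c 0 β / β ^ 0) = b 0 * (c 0 β / β ^ 0) + a 0 * (c 1 β / β ^ 1) := by
  have h1 := h.2.2.1 0 β
  rw [h.1, h.2.1] at h1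
  rw [h.1]
  field_simp
  linear_combination -h1

lemma eigenvector_succ (h : GCRec a b c g) (hpos : ∀ n, 0 < a n) {β : ℂ} (hβ : β ≠ 0) (n : ℕ) :
    (β + β⁻¹) * (c (n + 1) β / β ^ (n + 1)) = a n * (c n β / β ^ n) +
      b (n + 1) * (c (n + 1) β / β ^ (n + 1)) + a (n + 1) * (c (n + 2) β / β ^ (n + 2)) := by
  have h1 := h.2.2.1 (n + 1) β
  rw [h.g_succ hpos] at h1
  field_simp
  linear_combination -β ^ (2 * n + 2) * h1

/-- Solutions of the Jacobi eigenvalue equation are multiples of `n ↦ c n β / β ^ n`. -/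
lemma eigenvector_unique (h : GCRec a b c g) (hpos : ∀ n, 0 < a n) {β : ℂ} (hβ : β ≠ 0)
    {f : ℕ → ℂ} (h0 : (β + β⁻¹) * f 0 = b 0 * f 0 + a 0 * f 1)
    (h1 : ∀ n, (β + β⁻¹) * f (n + 1) =
      a n * f n + b (n + 1) * f (n + 1) + a (n + 1) * f (n + 2)) (n : ℕ) :
    f n = f 0 * (c n β / β ^ n) := by
  have ha : ∀ n, (a n : ℂ) ≠ 0 := fun n => by exact_mod_cast (hpos n).ne'
  suffices f n = f 0 * (c n β / β ^ n) ∧ f (n + 1) = f 0 * (c (n + 1) β / β ^ (n + 1)) from this.1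
  induction n with
  | zero =>
    refine ⟨by simp [h.1], mul_left_cancel₀ (ha 0) ?_⟩
    have h2 := h.eigenvector_zero hβ
    have h3 : c 0 β / β ^ 0 = 1 := by simp [h.1]
    rw [h3] at h2
    simp only [zero_add]
    linear_combination f 0 * h2 - h0
  | succ n ih =>
    refine ⟨ih.2, mul_left_cancel₀ (ha (n + 1)) ?_⟩
    have h2 := h.eigenvector_succ hpos hβ n
    have h3 := h1 n
    rw [ih.1, ih.2] at h3
    linear_combination f 0 * h2 - h3

end GCRec

theorem statement17 (a b : ℕ → ℝ) (hpos : ∀ n, 0 < a n)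
    (hsum : Summable fun n => |b n| + |a n ^ 2 - 1|)
    (u : ℂ → ℂ) (hu : IsJost a b u)
    (J : lp (fun _ : ℕ => ℂ) 2 →L[ℂ] lp (fun _ : ℕ => ℂ) 2)
    (hJ : IsJacobiOpC a b J)
    (β : ℂ) (hβ : β ∈ Metric.ball (0 : ℂ) 1) (hβ0 : β ≠ 0) :
    (u β = 0 ↔
      β.im = 0 ∧ ∃ f : lp (fun _ : ℕ => ℂ) 2, f ≠ 0 ∧ J f = (β + β⁻¹) • f) ∧
    (u β = 0 → deriv u β ≠ 0) := by
  obtain ⟨c, g, hgc, hg⟩ := hu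
  have hβ1 : ‖β‖ < 1 := mem_ball_zero_iff.1 hβ
  have hρ : 0 < ‖β‖ := norm_pos_iff.2 hβ0
  have hg' : ∀ z ∈ ball (0 : ℂ) 1, Tendsto (fun n => g n z) atTop (𝓝 (u z)) := fun z hz =>
    hg z ⟨ball_subset_closedBall hz, by
      rintro (rfl | rfl) <;> simp at hz⟩
  have hsuma : Summable fun n => |a n ^ 2 - 1| :=
    hsum.of_nonneg_of_le (fun n => abs_nonneg _) fun n => le_add_of_nonneg_left (abs_nonneg _)
  obtain ⟨⟨L, hL⟩, m, hm, hma⟩ := exists_tendsto_prod_of_summable hpos hsuma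
  have hN := hgc.isNormalizedGC
  have hv : ∀ z ∈ ball (0 : ℂ) 1,
      Tendsto (fun n => ((∏ k ∈ Finset.range n, a k : ℝ) : ℂ) * g n z) atTop (𝓝 (L * u z)) :=
    fun z hz => ((Complex.continuous_ofReal.tendsto _).comp hL).mul (hg' z hz)
  have habdd : BddAbove (Set.range a) := by
    obtain ⟨R, hR⟩ := hsuma.tendsto_atTop_zero.bddAbove_range
    refine ⟨R + 1, ?_⟩
    rintro _ ⟨n, rfl⟩
    have h1 : |a n ^ 2 - 1| ≤ R := hR ⟨n, rfl⟩
    have h2 := le_abs_self (a n ^ 2 - 1)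
    have h3 := abs_nonneg (a n ^ 2 - 1)
    nlinarith [hpos n]
  have forward : u β = 0 →
      β.im = 0 ∧ ∃ f : lp (fun _ : ℕ => ℂ) 2, f ≠ 0 ∧ J f = (β + β⁻¹) • f := by
    intro hu0
    have hG := hv β hβ
    rw [hu0, mul_zero] at hG
    obtain ⟨σ, hσ1, hσ2⟩ := exists_between (show ‖β‖ ^ 2 < ‖β‖ by nlinarith)
    have hσ0 : 0 < σ := (sq_nonneg _).trans_lt hσ1
    obtain ⟨M, hM, hd⟩ := hN.exists_decay hsum hβ1 hσ1 (hσ2.trans hβ1) hG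
    have hθ : σ / ‖β‖ < 1 := (div_lt_one hρ).2 hσ2
    have hp : ∀ n, ‖c n β / β ^ n‖ ≤ M / m * (σ / ‖β‖) ^ n := by
      intro n
      have h1 := (hd n).1
      rw [norm_mul, Complex.norm_real, Real.norm_of_nonneg (hm.le.trans (hma n))] at h1
      have h2 : m * ‖c n β‖ ≤ M * σ ^ n :=
        (mul_le_mul_of_nonneg_right (hma n) (norm_nonneg _)).trans h1
      rw [norm_div, norm_pow, div_pow, ← mul_div_assoc]
      gcongr
      rw [div_mul_eq_mul_div, le_div_iff₀ hm]
      linarith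
    have hp0 : Tendsto (fun n => c n β / β ^ n) atTop (𝓝 0) := by
      refine squeeze_zero_norm hp ?_
      simpa using (tendsto_pow_atTop_nhds_zero_of_lt_one (by positivity) hθ).const_mul (M / m)
    have hmem : Memℓp (fun n => c n β / β ^ n) 2 := by
      refine memℓp_gen ?_
      have h1 : Summable fun n => (M / m) ^ 2 * ((σ / ‖β‖) ^ 2) ^ n :=
        (summable_geometric_of_lt_one (by positivity)
          (pow_lt_one₀ (by positivity) hθ two_ne_zero)).mul_left _
      refine h1.of_nonneg_of_le (fun n => by positivity) fun n => ?_
      simp only [ENNReal.toReal_ofNat, Real.rpow_ofNat]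
      refine (pow_le_pow_left₀ (norm_nonneg _) (hp n) 2).trans_eq ?_
      rw [mul_pow, pow_right_comm]
    refine ⟨im_eq_zero_of_add_inv_im_eq_zero hβ1 hβ0
      (im_eq_zero_of_jacobi_eigenvector (hgc.eigenvector_zero hβ0)
        (hgc.eigenvector_succ hpos hβ0) habdd hpos hp0 (by simp [hgc.1])),
      ⟨_, hmem⟩, fun h => ?_, ?_⟩
    · have := congrArg (fun f : lp (fun _ : ℕ => ℂ) 2 => f 0) h
      simp [hgc.1] at this
    · ext n
      cases n with
      | zero => exact (hJ _).1.trans (hgc.eigenvector_zero hβ0).symm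
      | succ n => exact ((hJ _).2 n).trans (hgc.eigenvector_succ hpos hβ0 n).symm
  refine ⟨⟨forward, ?_⟩, fun hu0 hdu => ?_⟩
  · rintro ⟨-, f, hf0, hf⟩
    have hfn : ∀ n, J f n = (β + β⁻¹) * f n := fun n => by rw [hf]; rfl
    have huniq := hgc.eigenvector_unique hpos hβ0 (f := f)
      ((hfn 0).symm.trans (hJ f).1) fun n => (hfn (n + 1)).symm.trans ((hJ f).2 n)
    have hf00 : f 0 ≠ 0 := by
      intro h0
      refine hf0 (lp.ext (funext fun n => ?_))
      rw [huniq n, h0, zero_mul]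
      rfl
    have hflim : Tendsto (fun n => f n) atTop (𝓝 0) := by
      have h1 := (lp.memℓp f).summable (by norm_num)
      simp only [ENNReal.toReal_ofNat, Real.rpow_ofNat] at h1
      have h2 := h1.tendsto_atTop_zero.sqrt
      simp only [Real.sqrt_sq (norm_nonneg _), Real.sqrt_zero] at h2
      exact tendsto_zero_iff_norm_tendsto_zero.2 h2
    have hgf : ∀ n, f 0 * g (n + 1) β = β ^ (n + 1) * (f (n + 1) - a n * (β * f n)) := by
      intro n
      rw [hgc.g_succ hpos, huniq n, huniq (n + 1)]
      field_simp
      ring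
    obtain ⟨R, hR⟩ := habdd
    have h1 : Tendsto (fun n => (a n : ℂ) * (β * f n)) atTop (𝓝 0) := by
      refine squeeze_zero_norm (a := fun n => R * (‖β‖ * ‖f n‖)) (fun n => ?_) ?_
      · rw [norm_mul, norm_mul, Complex.norm_real, Real.norm_of_nonneg (hpos n).le]
        gcongr
        exact hR ⟨n, rfl⟩
      · simpa using (hflim.norm.const_mul ‖β‖).const_mul R
    have h2 : Tendsto (fun n => f 0 * g (n + 1) β) atTop (𝓝 (0 * (0 - 0))) := by
      simp only [hgf]
      exact ((tendsto_add_atTop_iff_nat 1).2 (tendsto_pow_atTop_nhds_zero_of_norm_lt_one hβ1)).mul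
        (((tendsto_add_atTop_iff_nat 1).2 hflim).sub h1)
    have h3 := tendsto_nhds_unique h2
      (((tendsto_add_atTop_iff_nat 1).2 (hg' β hβ)).const_mul (f 0))
    simpa [hf00] using h3.symm
  · have him := (forward hu0).1
    obtain ⟨t, rfl⟩ : ∃ t : ℝ, β = t := ⟨β.re, Complex.ext rfl him⟩
    have hG := hv t hβ
    rw [hu0, mul_zero] at hG
    have hG' := hN.tendsto_deriv hsum hv hβ
    rw [deriv_const_mul_field, hdu, mul_zero] at hG'
    exact hN.not_tendsto_deriv_zero hsum hm hma (by exact_mod_cast hβ0) (by simpa using hβ1) hG hG'
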